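/- arXiv:0911.4021 — 4 statements merged into one kernel-verified Lean document; each statement's English description precedes it below -/
import Mathlib

section
/- Moment property of the equivalent kernel. Let K : ℝ → ℝ be a bounded integrable function supported on [−1,1], let 𝒜 ⊆ ℝ be measurable, let p ≥ 0 and 0 ≤ r ≤ p be integers, and suppose det N_p(𝒜) ≠ 0. Then for every integer q with 0 ≤ q ≤ p, ∫_𝒜 z^q K_{r,p}(z;𝒜) dz = r! if q = r, and ∫_𝒜 z^q K_{r,p}(z;𝒜) dz = 0 if q ≠ r. -/
open MeasureTheory

noncomputable section

/-- `ν_ℓ(𝒜) = ∫_𝒜 z^ℓ K(z) dz`. -/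
def nuK (K : ℝ → ℝ) (A : Set ℝ) (l : ℕ) : ℝ := ∫ z in A, z ^ l * K z

/-- `N_p(𝒜)`: the `(p+1)×(p+1)` matrix whose (1-based) `(i,j)` entry is `ν_{i+j-2}(𝒜)`. -/
def NmatK (K : ℝ → ℝ) (A : Set ℝ) (p : ℕ) : Matrix (Fin (p + 1)) (Fin (p + 1)) ℝ :=
  Matrix.of fun i j => nuK K A ((i : ℕ) + (j : ℕ))

/-- `M_{r,p}(z;𝒜)`: `N_p(𝒜)` with its (1-based) `(r+1)`-th column replaced by `(1,z,…,z^p)ᵀ`. -/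
def MmatK (K : ℝ → ℝ) (A : Set ℝ) (p r : ℕ) (z : ℝ) : Matrix (Fin (p + 1)) (Fin (p + 1)) ℝ :=
  Matrix.of fun i j => if (j : ℕ) = r then z ^ (i : ℕ) else nuK K A ((i : ℕ) + (j : ℕ))

/-- The equivalent kernel `K_{r,p}(z;𝒜) = r!·(det M_{r,p}(z;𝒜)/det N_p(𝒜))·K(z)`. -/
def KeqK (K : ℝ → ℝ) (A : Set ℝ) (p r : ℕ) (z : ℝ) : ℝ :=
  (Nat.factorial r : ℝ) * ((MmatK K A p r z).det / (NmatK K A p).det) * K z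

/-- Every moment integrand of an integrable function vanishing off `[-1, 1]` is integrable. -/
theorem integrable_pow_mul_of_supported {K : ℝ → ℝ} (hKint : Integrable K)
    (hKsupp : ∀ z : ℝ, z ∉ Set.Icc (-1 : ℝ) 1 → K z = 0) (l : ℕ) :
    Integrable fun z => z ^ l * K z := by
  refine hKint.mono ((continuous_pow l).aestronglyMeasurable.mul hKint.aestronglyMeasurable)
    (Filter.Eventually.of_forall fun z => ?_)
  by_cases hz : z ∈ Set.Icc (-1 : ℝ) 1
  · rw [norm_mul, norm_pow]
    exact mul_le_of_le_one_left (norm_nonneg _)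
      (pow_le_one₀ (norm_nonneg _) (abs_le.mpr hz))
  · simp [hKsupp z hz]

/-- Expansion of `det M_{r,p}(z;𝒜)` along its replaced column. -/
theorem det_MmatK_eq_sum (K : ℝ → ℝ) (A : Set ℝ) (p : ℕ) (r : Fin (p + 1)) (z : ℝ) :
    (MmatK K A p r z).det = ∑ i, (NmatK K A p).adjugate r i * z ^ (i : ℕ) := by
  have hM : MmatK K A p r z = (NmatK K A p).updateCol r fun i => z ^ (i : ℕ) := by
    ext i j
    simp [MmatK, NmatK, Matrix.updateCol_apply, Fin.ext_iff]
  rw [hM, ← Matrix.cramer_apply, Matrix.cramer_eq_adjugate_mulVec]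
  rfl

/-- **Moment property of the equivalent kernel.**  For `0 ≤ q ≤ p`,
`∫_𝒜 z^q K_{r,p}(z;𝒜) dz = r!` if `q = r` and `= 0` otherwise. -/
theorem equivalent_kernel_moments
    (K : ℝ → ℝ) (hKbdd : ∃ C : ℝ, ∀ z, |K z| ≤ C) (hKint : Integrable K)
    (hKsupp : ∀ z : ℝ, z ∉ Set.Icc (-1 : ℝ) 1 → K z = 0)
    (A : Set ℝ) (hA : MeasurableSet A)
    (p r : ℕ) (hr : r ≤ p)
    (hdet : (NmatK K A p).det ≠ 0) :
    ∀ q : ℕ, q ≤ p →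
      (∫ z in A, z ^ q * KeqK K A p r z) =
        if q = r then (Nat.factorial r : ℝ) else 0 := by
  intro q hq
  lift r to Fin (p + 1) using Nat.lt_succ_of_le hr
  lift q to Fin (p + 1) using Nat.lt_succ_of_le hq
  set c : ℝ := (Nat.factorial r : ℝ) / (NmatK K A p).det with hc
  have hexp : ∀ z, z ^ (q : ℕ) * KeqK K A p r z =
      ∑ i, c * (NmatK K A p).adjugate r i * (z ^ ((i : ℕ) + (q : ℕ)) * K z) := by
    intro z
    calc z ^ (q : ℕ) * KeqK K A p r z
        = c * z ^ (q : ℕ) * K z * ∑ i, (NmatK K A p).adjugate r i * z ^ (i : ℕ) := by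
          rw [KeqK, det_MmatK_eq_sum, hc]
          ring
      _ = _ := by
          rw [Finset.mul_sum]
          exact Finset.sum_congr rfl fun i _ => by ring
  have hadj : ∑ i, (NmatK K A p).adjugate r i * nuK K A ((i : ℕ) + (q : ℕ)) =
      (NmatK K A p).det * (1 : Matrix (Fin (p + 1)) (Fin (p + 1)) ℝ) r q :=
    congrFun (congrFun (Matrix.adjugate_mul (NmatK K A p)) r) q
  simp_rw [hexp]
  rw [integral_finsetSum _ fun i _ =>
    ((integrable_pow_mul_of_supported hKint hKsupp _).integrableOn.const_mul _)]
  simp_rw [integral_const_mul, mul_assoc, ← Finset.mul_sum]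
  change c * ∑ i, (NmatK K A p).adjugate r i * nuK K A ((i : ℕ) + (q : ℕ)) = _
  rw [hadj, hc, ← mul_assoc, div_mul_cancel₀ _ hdet, Matrix.one_apply, mul_ite, mul_one, mul_zero]
  simp only [← Fin.ext_iff, eq_comm]

end
end

section
/- Hankel matrix identity, rows i ≥ 2. Let ν_0, ν_1, …, ν_{2p+1} be real numbers, let N be the (p+1)×(p+1) matrix with (k,l) entry ν_{k+l−2}, assumed invertible, and let Q be the (p+1)×(p+1) matrix with (k,l) entry ν_{k+l−1}. Then for every i with 2 ≤ i ≤ p+1 and every j with 1 ≤ j ≤ p+1, (N^{-1} Q N^{-1})_{ij} = (N^{-1})_{i−1,j} + {Σ_{k=1}^{p+1} (N^{-1})_{i,k}·ν_{p+k}}·(N^{-1})_{p+1,j}. -/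
noncomputable section

/-- **Hankel matrix identity, rows `i ≥ 2`.**
Let `ν_0, …, ν_{2p+1}` be real numbers, `N` the `(p+1)×(p+1)` matrix with 1-based `(k,l)` entry
`ν_{k+l−2}` (assumed invertible) and `Q` the one with entry `ν_{k+l−1}`.  Then for every 1-based
row index `i` with `2 ≤ i ≤ p+1` (i.e. 0-based `i` with `1 ≤ i ≤ p`) and every column `j`,
`(N⁻¹ Q N⁻¹)_{ij} = (N⁻¹)_{i−1,j} + (Σ_{k=1}^{p+1} (N⁻¹)_{i,k} ν_{p+k})·(N⁻¹)_{p+1,j}`. -/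
theorem hankel_identity_lower_rows
    (p : ℕ) (ν : ℕ → ℝ)
    (N Q : Matrix (Fin (p + 1)) (Fin (p + 1)) ℝ)
    (hN : ∀ k l : Fin (p + 1), N k l = ν ((k : ℕ) + (l : ℕ)))
    (hQ : ∀ k l : Fin (p + 1), Q k l = ν ((k : ℕ) + (l : ℕ) + 1))
    (hNinv : IsUnit N.det)
    (i j : Fin (p + 1)) (hi : 1 ≤ (i : ℕ)) :
    (N⁻¹ * Q * N⁻¹) i j =
      N⁻¹ ⟨(i : ℕ) - 1, by omega⟩ j +
        (∑ k : Fin (p + 1), N⁻¹ i k * ν (p + 1 + (k : ℕ))) * N⁻¹ (Fin.last p) j := by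
  obtain ⟨m, rfl⟩ : ∃ m : Fin p, i = m.succ :=
    ⟨⟨(i : ℕ) - 1, by omega⟩, Fin.ext (by simp; omega)⟩
  have shift (l : Fin p) : (N⁻¹ * Q) m.succ l.castSucc = if m = l then 1 else 0 := by
    calc (N⁻¹ * Q) m.succ l.castSucc = (N⁻¹ * N) m.succ l.succ := by
          simp [Matrix.mul_apply, hN, hQ, add_assoc]
      _ = if m = l then 1 else 0 := by
          simp [Matrix.nonsing_inv_mul N hNinv, Matrix.one_apply]
  have last_column : (N⁻¹ * Q) m.succ (Fin.last p) =
      ∑ k : Fin (p + 1), N⁻¹ m.succ k * ν (p + 1 + (k : ℕ)) := by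
    simp only [Matrix.mul_apply, hQ, Fin.val_last]
    refine Finset.sum_congr rfl fun k _ => ?_
    congr 2
    omega
  rw [Matrix.mul_apply, Fin.sum_univ_castSucc, last_column]
  simp only [shift, ite_mul, one_mul, zero_mul, Finset.sum_ite_eq, Finset.mem_univ, if_true]
  rfl

end
end

section
/- Hankel matrix identity, first row. Let ν_0, ν_1, …, ν_{2p+1} be real numbers, let N be the (p+1)×(p+1) matrix with (k,l) entry ν_{k+l−2}, assumed invertible, and let Q be the (p+1)×(p+1) matrix with (k,l) entry ν_{k+l−1}. Then for every j with 1 ≤ j ≤ p+1, (N^{-1} Q N^{-1})_{1j} = {Σ_{k=1}^{p+1} (N^{-1})_{1,k}·ν_{p+k}}·(N^{-1})_{p+1,j}. -/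
noncomputable section

/-- **Hankel matrix identity, first row.**
Let `ν_0, …, ν_{2p+1}` be real numbers, `N` the `(p+1)×(p+1)` matrix with 1-based `(k,l)` entry
`ν_{k+l−2}` (assumed invertible) and `Q` the one with entry `ν_{k+l−1}`.  Then for every column
`j` (1-based `1 ≤ j ≤ p+1`),
`(N⁻¹ Q N⁻¹)_{1j} = (Σ_{k=1}^{p+1} (N⁻¹)_{1,k} ν_{p+k})·(N⁻¹)_{p+1,j}`. -/
theorem hankel_identity_first_row
    (p : ℕ) (ν : ℕ → ℝ)
    (N Q : Matrix (Fin (p + 1)) (Fin (p + 1)) ℝ)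
    (hN : ∀ k l : Fin (p + 1), N k l = ν ((k : ℕ) + (l : ℕ)))
    (hQ : ∀ k l : Fin (p + 1), Q k l = ν ((k : ℕ) + (l : ℕ) + 1))
    (hNinv : IsUnit N.det)
    (j : Fin (p + 1)) :
    (N⁻¹ * Q * N⁻¹) 0 j =
      (∑ k : Fin (p + 1), N⁻¹ 0 k * ν (p + 1 + (k : ℕ))) * N⁻¹ (Fin.last p) j := by
  have row : ∀ l : Fin p, (N⁻¹ * Q) 0 l.castSucc = 0 := by
    intro l
    have shift : (N⁻¹ * Q) 0 l.castSucc = (N⁻¹ * N) 0 l.succ := by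
      simp only [Matrix.mul_apply, hN, hQ, Fin.val_castSucc, Fin.val_succ, add_assoc]
    rw [shift, Matrix.nonsing_inv_mul N hNinv, Matrix.one_apply_ne (Fin.succ_ne_zero l).symm]
  have last : (N⁻¹ * Q) 0 (Fin.last p) = ∑ k : Fin (p + 1), N⁻¹ 0 k * ν (p + 1 + (k : ℕ)) := by
    simp only [Matrix.mul_apply, hQ, Fin.val_last, add_assoc, add_comm, add_left_comm]
  rw [Matrix.mul_apply, Fin.sum_univ_castSucc, last]
  simp [row]

end
end

section
/- Recursion for the errors of the derivative estimators. Let p ≥ 1 and γ ≥ 0, let η_0 and x ↦ η(x,α) be p-times differentiable at x_0 with η(·,α) positive in a neighborhood of x_0, and set φ_{α,γ}(x) = (η_0(x) − η(x,α))/η(x,α)^γ. Given any real numbers β̂_0, …, β̂_p, define η̂_{u,0} = β̂_0 and, recursively for 1 ≤ j ≤ p, η̂_{u,j} = j!·β̂_j − η(x_0,α)^γ·Σ_{i=0}^{j−1} η̂_{u,i}·(1/η^γ)^{(j−i)}(x_0,α)·C(j,i) + η(x_0,α)^γ·(η^{1−γ})^{(j)}(x_0,α), where C(j,i) = j!/(i!(j−i)!).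 Then for every 1 ≤ j ≤ p, η̂_{u,j} − η_0^{(j)}(x_0) = j!·β̂_j − η(x_0,α)^γ·φ_{α,γ}^{(j)}(x_0) − η(x_0,α)^γ·Σ_{i=0}^{j−1} (η̂_{u,i} − η_0^{(i)}(x_0))·(1/η^γ)^{(j−i)}(x_0,α)·C(j,i). Consequently, writing v_j = j!β̂_j − η(x_0,α)^γφ_{α,γ}^{(j)}(x_0) − η(x_0,α)^γ·1{j=0} and w_j = η̂_{u,j} − η_0^{(j)}(x_0), the error vector satisfies the triangular recursion w_j = v_j − Σ_{i=0}^{j−1} ω_{i,j} w_i with ω_{i,j} = C(j,i)·(1/η^γ)^{(j−i)}(x_0,α)·η(x_0,α)^γ. -/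
open Finset

noncomputable section

/-- The nonparametric correction function `φ_{α,γ}(x) = (η₀(x) − η(x,α))/η(x,α)^γ`
(here `ηg = η(·,α)` is the fixed parametric guide and `^` is the real power). -/
def phiFn (η0 ηg : ℝ → ℝ) (γ : ℝ) (x : ℝ) : ℝ := (η0 x - ηg x) / ηg x ^ γ

/-- **Recursion for the errors of the derivative estimators.**
Let `p ≥ 1`, `γ ≥ 0`, let `η₀` and `ηg = η(·,α)` be `p`-times differentiable at `x₀` with `ηg`
positive in a neighbourhood of `x₀`.  Given reals `β̂_0,…,β̂_p`, define `η̂_{u,0} = β̂_0` and,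
recursively for `1 ≤ j ≤ p`,
`η̂_{u,j} = j!·β̂_j − ηg(x₀)^γ·Σ_{i=0}^{j−1} η̂_{u,i}·(1/ηg^γ)^{(j−i)}(x₀)·C(j,i)
           + ηg(x₀)^γ·(ηg^{1−γ})^{(j)}(x₀)`  with  `C(j,i) = j!/(i!(j−i)!)`.
Then for every `1 ≤ j ≤ p`,
`η̂_{u,j} − η₀^{(j)}(x₀) = j!·β̂_j − ηg(x₀)^γ·φ^{(j)}(x₀)
   − ηg(x₀)^γ·Σ_{i=0}^{j−1} (η̂_{u,i} − η₀^{(i)}(x₀))·(1/ηg^γ)^{(j−i)}(x₀)·C(j,i)`;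
consequently, with `v_j = j!β̂_j − ηg(x₀)^γ φ^{(j)}(x₀) − ηg(x₀)^γ·1{j=0}`,
`w_j = η̂_{u,j} − η₀^{(j)}(x₀)` and `ω_{i,j} = C(j,i)·(1/ηg^γ)^{(j−i)}(x₀)·ηg(x₀)^γ`, the errors
satisfy the triangular recursion `w_j = v_j − Σ_{i=0}^{j−1} ω_{i,j} w_i` for `1 ≤ j ≤ p`. -/
theorem derivative_estimator_error_recursion
    (p : ℕ) (hp : 1 ≤ p) (γ : ℝ) (hγ : 0 ≤ γ)
    (η0 ηg : ℝ → ℝ) (x0 : ℝ)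
    (hη0 : ContDiffAt ℝ p η0 x0) (hηg : ContDiffAt ℝ p ηg x0)
    (hpos : ∀ᶠ x in nhds x0, 0 < ηg x)
    (betaHat : ℕ → ℝ) (etaHat : ℕ → ℝ)
    (hinit : etaHat 0 = betaHat 0)
    (hrec : ∀ j : ℕ, 1 ≤ j → j ≤ p →
      etaHat j =
        (Nat.factorial j : ℝ) * betaHat j -
          ηg x0 ^ γ *
            ∑ i ∈ range j,
              etaHat i * iteratedDeriv (j - i) (fun x => 1 / ηg x ^ γ) x0 *
                ((Nat.factorial j : ℝ) / ((Nat.factorial i : ℝ) * (Nat.factorial (j - i) : ℝ))) +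
          ηg x0 ^ γ * iteratedDeriv j (fun x => ηg x ^ (1 - γ)) x0) :
    (∀ j : ℕ, 1 ≤ j → j ≤ p →
      etaHat j - iteratedDeriv j η0 x0 =
        (Nat.factorial j : ℝ) * betaHat j - ηg x0 ^ γ * iteratedDeriv j (phiFn η0 ηg γ) x0 -
          ηg x0 ^ γ *
            ∑ i ∈ range j,
              (etaHat i - iteratedDeriv i η0 x0) *
                iteratedDeriv (j - i) (fun x => 1 / ηg x ^ γ) x0 *
                ((Nat.factorial j : ℝ) / ((Nat.factorial i : ℝ) * (Nat.factorial (j - i) : ℝ)))) ∧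
    (∀ v w : ℕ → ℝ,
      (∀ j : ℕ, v j =
        (Nat.factorial j : ℝ) * betaHat j - ηg x0 ^ γ * iteratedDeriv j (phiFn η0 ηg γ) x0 -
          ηg x0 ^ γ * (if j = 0 then 1 else 0)) →
      (∀ j : ℕ, w j = etaHat j - iteratedDeriv j η0 x0) →
      ∀ j : ℕ, 1 ≤ j → j ≤ p →
        w j = v j - ∑ i ∈ range j,
          (((Nat.factorial j : ℝ) / ((Nat.factorial i : ℝ) * (Nat.factorial (j - i) : ℝ))) *
              iteratedDeriv (j - i) (fun x => 1 / ηg x ^ γ) x0 * ηg x0 ^ γ) * w i) := by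
  have hx0 : 0 < ηg x0 := hpos.self_of_nhds
  have hinv : ContDiffAt ℝ p (fun x => 1 / ηg x ^ γ) x0 :=
    contDiffAt_const.div (hηg.rpow_const_of_ne hx0.ne') (Real.rpow_pos_of_pos hx0 γ).ne'
  have hpow : ContDiffAt ℝ p (fun x => ηg x ^ (1 - γ)) x0 := hηg.rpow_const_of_ne hx0.ne'
  have hphi : ContDiffAt ℝ p (phiFn η0 ηg γ) x0 :=
    (hη0.sub hηg).div (hηg.rpow_const_of_ne hx0.ne') (Real.rpow_pos_of_pos hx0 γ).ne'
  have hdecomp : (fun x => η0 x * (1 / ηg x ^ γ)) =ᶠ[nhds x0]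
      fun x => phiFn η0 ηg γ x + ηg x ^ (1 - γ) := by
    filter_upwards [hpos] with x hx
    rw [phiFn, Real.rpow_sub hx, Real.rpow_one]
    ring
  have hleib : ∀ j ≤ p, ηg x0 ^ γ * ∑ i ∈ range j, iteratedDeriv i η0 x0 *
        iteratedDeriv (j - i) (fun x => 1 / ηg x ^ γ) x0 *
          ((Nat.factorial j : ℝ) / ((Nat.factorial i : ℝ) * (Nat.factorial (j - i) : ℝ))) +
        iteratedDeriv j η0 x0 =
      ηg x0 ^ γ * iteratedDeriv j (phiFn η0 ηg γ) x0 +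
        ηg x0 ^ γ * iteratedDeriv j (fun x => ηg x ^ (1 - γ)) x0 := by
    intro j hj
    have hjp : (j : WithTop ℕ∞) ≤ p := by exact_mod_cast hj
    have h := hdecomp.iteratedDeriv_eq j
    rw [iteratedDeriv_fun_mul (hη0.of_le hjp) (hinv.of_le hjp),
      iteratedDeriv_fun_add (hphi.of_le hjp) (hpow.of_le hjp), sum_range_succ] at h
    have hsum : ∀ i ∈ range j, (j.choose i : ℝ) * iteratedDeriv i η0 x0 *
        iteratedDeriv (j - i) (fun x => 1 / ηg x ^ γ) x0 =
        iteratedDeriv i η0 x0 * iteratedDeriv (j - i) (fun x => 1 / ηg x ^ γ) x0 *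
          ((Nat.factorial j : ℝ) / ((Nat.factorial i : ℝ) * (Nat.factorial (j - i) : ℝ))) := by
      intro i hi
      rw [Nat.cast_choose ℝ (mem_range.mp hi).le]
      ring
    rw [sum_congr rfl hsum] at h
    simp only [Nat.choose_self, Nat.cast_one, one_mul, Nat.sub_self, iteratedDeriv_zero] at h
    linear_combination ηg x0 ^ γ * h -
      iteratedDeriv j η0 x0 * mul_one_div_cancel (Real.rpow_pos_of_pos hx0 γ).ne'
  have herr : ∀ j : ℕ, 1 ≤ j → j ≤ p →
      etaHat j - iteratedDeriv j η0 x0 =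
        (Nat.factorial j : ℝ) * betaHat j - ηg x0 ^ γ * iteratedDeriv j (phiFn η0 ηg γ) x0 -
          ηg x0 ^ γ *
            ∑ i ∈ range j,
              (etaHat i - iteratedDeriv i η0 x0) *
                iteratedDeriv (j - i) (fun x => 1 / ηg x ^ γ) x0 *
                ((Nat.factorial j : ℝ) /
                  ((Nat.factorial i : ℝ) * (Nat.factorial (j - i) : ℝ))) := by
    intro j hj1 hjp
    simp only [sub_mul, sum_sub_distrib]
    linear_combination hrec j hj1 hjp - hleib j hjp
  refine ⟨herr, fun v w hv hw j hj1 hjp => ?_⟩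
  rw [hw, hv, herr j hj1 hjp, if_neg (by lia), mul_zero, sub_zero, mul_sum]
  congr 1
  refine sum_congr rfl fun i _ => ?_
  rw [hw]
  ring

end
end
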